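/- For every vertex x of the digraph D: every word in the set δ(p_x x) (the set of concatenations of the word assigned to p_x with a word in δ(x)) is left extremal square-free, and every word in the set δ(x s_x) is right extremal square-free. -/

import Mathlib

/-- A word `w` is square-free if it contains no factor `x ++ x` with `x` nonempty. -/
def SquareFree {α : Type*} (w : List α) : Prop :=
  ∀ x : List α, x ≠ [] → ¬ (x ++ x) <:+: w

/-- `v` is an extension of `w`: insert a single letter anywhere in `w`. -/
def IsExtension {α : Type*} (w v : List α) : Prop :=
  ∃ (w' w'' : List α) (a : α), w = w' ++ w'' ∧ v = w' ++ [a] ++ w''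

/-- `w` is extremal square-free. -/
def ExtremalSquareFree {α : Type*} (w : List α) : Prop :=
  SquareFree w ∧ ∀ v, IsExtension w v → ¬ SquareFree v

/-- Every square-free extension of `w` is a right extension, and `w` is square-free. -/
def LeftExtremalSquareFree {α : Type*} (w : List α) : Prop :=
  SquareFree w ∧ ∀ v, IsExtension w v → SquareFree v → ∃ a : α, v = w ++ [a]

/-- Every square-free extension of `w` is a left extension, and `w` is square-free. -/
def RightExtremalSquareFree {α : Type*} (w : List α) : Prop :=
  SquareFree w ∧ ∀ v, IsExtension w v → SquareFree v → ∃ a : α, v = a :: w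

/-- Extension of a set-valued substitution from letters to words:
`SubstSet f (a₁ ⋯ aₙ) = {A₁ ++ ⋯ ++ Aₙ : Aᵢ ∈ f aᵢ}`. -/
def SubstSet {α β : Type*} (f : α → Set (List β)) : List α → Set (List β)
  | [] => {[]}
  | a :: w => {W | ∃ A ∈ f a, ∃ B ∈ SubstSet f w, W = A ++ B}

/-- The word `P = abacbcabcbacabacbcabcbabcacbcabcbacabacbcabcbacbc` (a=0, b=1, c=2). -/
def Pw : List (Fin 3) :=
  [0,1,0,2,1,2,0,1,2,1,0,2,0,1,0,2,1,2,0,1,2,1,0,1,2,0,2,1,2,0,1,2,1,0,2,0,1,0,2,1,2,0,1,2,1,0,2,1,2]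

/-- The word `Q = abacbabcacbacabacbcacbacabcbabcabacbcabcb`. -/
def Qw : List (Fin 3) :=
  [0,1,0,2,1,0,1,2,0,2,1,0,2,0,1,0,2,1,2,0,2,1,0,2,0,1,2,1,0,1,2,0,1,0,2,1,2,0,1,2,1]

/-- The word `R = abacabcacbacabcbabcacbacabacbcacbacabcbabcabacbcabcb`. -/
def Rw : List (Fin 3) :=
  [0,1,0,2,0,1,2,0,2,1,0,2,0,1,2,1,0,1,2,0,2,1,0,2,0,1,0,2,1,2,0,2,1,0,2,0,1,2,1,0,1,2,0,1,0,2,1,2,0,1,2,1]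

/-- The word `S = acabacbabcacbacabcbacbcabacbabcacbacabcbabcacbaca`. -/
def Sw : List (Fin 3) :=
  [0,2,0,1,0,2,1,0,1,2,0,2,1,0,2,0,1,2,1,0,2,1,2,0,1,0,2,1,0,1,2,0,2,1,0,2,0,1,2,1,0,1,2,0,2,1,0,2,0]

/-- The identity permutation `()` of `Γ = {a,b,c}` (with `a = 0`, `b = 1`, `c = 2`). -/
def pid : Equiv.Perm (Fin 3) := 1
/-- The permutation `(ab)`. -/
def pab : Equiv.Perm (Fin 3) := Equiv.swap 0 1
/-- The permutation `(ac)`. -/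
def pac : Equiv.Perm (Fin 3) := Equiv.swap 0 2
/-- The permutation `(bc)`. -/
def pbc : Equiv.Perm (Fin 3) := Equiv.swap 1 2
/-- The permutation `(abc)`, i.e. `a ↦ b ↦ c ↦ a`. -/
def pabc : Equiv.Perm (Fin 3) := (Equiv.swap 0 1).trans (Equiv.swap 0 2)
/-- The permutation `(acb)`, i.e. `a ↦ c ↦ b ↦ a`. -/
def pacb : Equiv.Perm (Fin 3) := (Equiv.swap 0 2).trans (Equiv.swap 0 1)

/-- The vertex set `V(D) = S_Γ ∪ S̃_Γ`: a permutation `π` together with a Boolean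
which is `false` for the plain letter `π` and `true` for its mirror image `π̃`. -/
abbrev V : Type := Equiv.Perm (Fin 3) × Bool

/-- The 24 arcs of the digraph `D`. -/
def arcs : List (V × V) :=
  [((pid,false),(pab,true)), ((pac,true),(pid,false)), ((pab,false),(pid,true)),
   ((pacb,true),(pab,false)), ((pid,true),(pac,false)), ((pac,false),(pabc,true)),
   ((pabc,true),(pbc,false)), ((pbc,false),(pacb,true)), ((pabc,false),(pac,true)),
   ((pbc,true),(pabc,false)), ((pab,true),(pacb,false)), ((pacb,false),(pbc,true)),
   ((pid,false),(pbc,false)), ((pbc,false),(pid,false)), ((pab,false),(pabc,false)),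
   ((pabc,false),(pab,false)), ((pac,false),(pacb,false)), ((pacb,false),(pac,false)),
   ((pbc,true),(pid,true)), ((pid,true),(pbc,true)), ((pabc,true),(pab,true)),
   ((pab,true),(pabc,true)), ((pacb,true),(pac,true)), ((pac,true),(pacb,true))]

/-- The arc relation of the digraph `D`. -/
def Arc (x y : V) : Prop := (x, y) ∈ arcs

/-- For `x = (π, false)` this is `W_π` (permute letters by `π`);
for `x = (π, true)` this is `W_π̃` (the reversal of `W_π`). -/
def applyV (x : V) (w : List (Fin 3)) : List (Fin 3) :=
  if x.2 then (w.map x.1).reverse else w.map x.1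

/-- The vertex set of `D̂`: original vertices `Sum.inl x`, plus the new letters
`p_x = Sum.inr (x, false)` and `s_x = Sum.inr (x, true)`. -/
abbrev Vhat : Type := V ⊕ (V × Bool)

/-- The arc relation of the digraph `D̂`: the arcs of `D`, together with an arc
from `p_x` to `x` and an arc from `x` to `s_x`, for each vertex `x` of `D`. -/
def ArcHat : Vhat → Vhat → Prop
  | Sum.inl x, Sum.inl y => Arc x y
  | Sum.inr (x, false), Sum.inl y => x = y
  | Sum.inl x, Sum.inr (y, true) => x = y
  | _, _ => False

/-- The unique word in `δ(p_x)`: `P_x` if `x ∈ S_Γ`, and `S_x` if `x ∈ S̃_Γ`. -/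
def pword (x : V) : List (Fin 3) := applyV x (if x.2 then Sw else Pw)

/-- The unique word in `δ(s_x)`: `S_x` if `x ∈ S_Γ`, and `P_x` if `x ∈ S̃_Γ`. -/
def sword (x : V) : List (Fin 3) := applyV x (if x.2 then Pw else Sw)

/-- The substitution `δ` on the letters of `V(D̂)`. -/
def delta : Vhat → Set (List (Fin 3))
  | Sum.inl x => {applyV x Qw, applyV x Rw}
  | Sum.inr (x, false) => {pword x}
  | Sum.inr (x, true) => {sword x}

/-- The words `u` and `v` have a common prefix of length `k`. -/
def agree {α : Type*} [DecidableEq α] : ℕ → List α → List α → Bool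
  | 0, _, _ => true
  | k + 1, a :: u, b :: v => decide (a = b) && agree k u v
  | _ + 1, _, _ => false

/-- For `s = t.drop p`, the word `t` has a factor `x ++ x` with `x` of length `p`. -/
def hasSquareOfPeriod {α : Type*} [DecidableEq α] (p : ℕ) : List α → List α → Bool
  | a :: t, b :: s => agree p (a :: t) (b :: s) || hasSquareOfPeriod p t s
  | _, _ => false

/-- The word `w` contains a nonempty square. -/
def hasSquare {α : Type*} [DecidableEq α] (w : List α) : Bool :=
  (List.range w.length).any fun p => hasSquareOfPeriod (p + 1) w (w.drop (p + 1))

/-- `w` is square-free, and inserting a letter anywhere but at its right end creates a square.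
The square is first looked for among the letters at distance at most `8` from the new one, which
settles most cases cheaply. -/
def leftExtremalCheck (w : List (Fin 3)) : Bool :=
  !hasSquare w && (List.range w.length).all fun k =>
    (List.finRange 3).all fun a => [8, w.length].any fun r =>
      hasSquare ((w.take k).drop (k - r) ++ [a] ++ (w.drop k).take r)

theorem agree_iff {α : Type*} [DecidableEq α] (k : ℕ) (u v : List α) :
    agree k u v = true ↔ ∃ x : List α, x.length = k ∧ x <+: u ∧ x <+: v := by
  induction k generalizing u v with
  | zero => simp [agree]
  | succ k ih =>
    cases u with
    | nil =>
      simp only [agree, Bool.false_eq_true, List.prefix_nil, false_iff]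
      rintro ⟨x, hx, rfl, -⟩
      simp at hx
    | cons a u =>
      cases v with
      | nil =>
        simp only [agree, Bool.false_eq_true, List.prefix_nil, false_iff]
        rintro ⟨x, hx, -, rfl⟩
        simp at hx
      | cons b v =>
        simp only [agree, Bool.and_eq_true, decide_eq_true_eq, ih]
        constructor
        · rintro ⟨rfl, x, hx, hu, hv⟩
          exact ⟨a :: x, by simp [hx], by simpa using hu, by simpa using hv⟩
        · rintro ⟨x, hx, hu, hv⟩
          cases x with
          | nil => simp at hx
          | cons c x =>
            rw [List.cons_prefix_cons] at hu hv
            exact ⟨hu.1.symm.trans hv.1, x, by simpa using hx, hu.2, hv.2⟩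

theorem agree_drop_iff {α : Type*} [DecidableEq α] (p : ℕ) (t : List α) :
    agree p t (t.drop p) = true ↔ ∃ x : List α, x.length = p ∧ x ++ x <+: t := by
  rw [agree_iff]
  refine exists_congr fun x => and_congr_right fun hx => ?_
  subst hx
  constructor
  · rintro ⟨⟨u, rfl⟩, h⟩
    simpa using h
  · rintro ⟨u, rfl⟩
    simp

theorem hasSquareOfPeriod_iff {α : Type*} [DecidableEq α] {p : ℕ} (hp : 0 < p) (t : List α) :
    hasSquareOfPeriod p t (t.drop p) = true ↔
      ∃ x : List α, x.length = p ∧ x ++ x <:+: t := by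
  induction t with
  | nil =>
    simp only [hasSquareOfPeriod, Bool.false_eq_true, List.infix_nil, false_iff]
    rintro ⟨x, hx, h⟩
    simp_all
  | cons a t ih =>
    rcases h : (a :: t).drop p with _ | ⟨b, s⟩
    · simp only [hasSquareOfPeriod, Bool.false_eq_true, false_iff]
      rintro ⟨x, hx, hxt⟩
      have hle := hxt.length_le
      have hge := List.drop_eq_nil_iff.mp h
      rw [List.length_append] at hle
      omega
    · have hs : s = t.drop p := by
        rw [← List.tail_cons (a := b) (as := s), ← h, List.tail_drop, List.drop_succ_cons]
      rw [hasSquareOfPeriod, Bool.or_eq_true, ← h, agree_drop_iff, hs, ih]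
      simp only [List.infix_cons_iff, and_or_left, exists_or]

theorem hasSquare_iff {α : Type*} [DecidableEq α] (w : List α) :
    hasSquare w = true ↔ ¬ SquareFree w := by
  simp only [hasSquare, List.any_eq_true, List.mem_range, hasSquareOfPeriod_iff (Nat.succ_pos _),
    SquareFree, not_forall, not_not, exists_prop]
  constructor
  · rintro ⟨p, -, x, hx, h⟩
    exact ⟨x, by rintro rfl; simp at hx, h⟩
  · rintro ⟨x, hx, h⟩
    have hpos := List.length_pos_iff.mpr hx
    have hle := h.length_le
    rw [List.length_append] at hle
    exact ⟨x.length - 1, by omega, x, by omega, h⟩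

theorem SquareFree.of_infix {α : Type*} {u w : List α} (h : SquareFree w) (huw : u <:+: w) :
    SquareFree u :=
  fun x hx hxu => h x hx (hxu.trans huw)

theorem leftExtremalSquareFree_of_check {w : List (Fin 3)} (h : leftExtremalCheck w = true) :
    LeftExtremalSquareFree w := by
  simp only [leftExtremalCheck, Bool.and_eq_true, Bool.not_eq_true', List.all_eq_true,
    List.mem_range, List.any_eq_true, hasSquare_iff] at h
  refine ⟨?_, ?_⟩
  · by_contra hw
    rw [(hasSquare_iff w).mpr hw] at h
    simp at h
  · rintro v ⟨w', w'', a, rfl, rfl⟩ hv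
    rcases eq_or_ne w'' [] with rfl | hne
    · exact ⟨a, by simp⟩
    · have hpos := List.length_pos_iff.mpr hne
      obtain ⟨r, -, hr⟩ := h.2 w'.length (by simp [hpos]) a (List.mem_finRange a)
      rw [List.take_left, List.drop_left] at hr
      exact absurd (hv.of_infix ⟨w'.take (w'.length - r), w''.drop r, by
        simp only [← List.append_assoc, List.take_append_drop]
        simp⟩) hr

theorem SquareFree.reverse {α : Type*} {w : List α} (h : SquareFree w) :
    SquareFree w.reverse := by
  intro x hx hxw
  refine h x.reverse (by simpa using hx) ?_
  rw [← List.reverse_infix]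
  simpa using hxw

theorem SquareFree.of_map {α β : Type*} (f : α → β) {w : List α} (h : SquareFree (w.map f)) :
    SquareFree w := by
  intro x hx hxw
  refine h (x.map f) (by simpa using hx) ?_
  simpa using hxw.map f

theorem SquareFree.map_equiv {α β : Type*} (e : α ≃ β) {w : List α} (h : SquareFree w) :
    SquareFree (w.map e) :=
  SquareFree.of_map e.symm (by simpa using h)

theorem IsExtension.reverse {α : Type*} {w v : List α} (h : IsExtension w v) :
    IsExtension w.reverse v.reverse := by
  obtain ⟨w', w'', a, rfl, rfl⟩ := h
  exact ⟨w''.reverse, w'.reverse, a, by simp, by simp⟩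

theorem IsExtension.map {α β : Type*} (f : α → β) {w v : List α} (h : IsExtension w v) :
    IsExtension (w.map f) (v.map f) := by
  obtain ⟨w', w'', a, rfl, rfl⟩ := h
  exact ⟨w'.map f, w''.map f, f a, by simp, by simp⟩

theorem LeftExtremalSquareFree.reverse {α : Type*} {w : List α}
    (h : LeftExtremalSquareFree w) : RightExtremalSquareFree w.reverse := by
  refine ⟨h.1.reverse, fun v hv hsq => ?_⟩
  obtain ⟨a, ha⟩ := h.2 v.reverse (by simpa using hv.reverse) hsq.reverse
  exact ⟨a, by simpa using congrArg List.reverse ha⟩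

theorem LeftExtremalSquareFree.map_equiv {α β : Type*} (e : α ≃ β) {w : List α}
    (h : LeftExtremalSquareFree w) : LeftExtremalSquareFree (w.map e) := by
  refine ⟨h.1.map_equiv e, fun v hv hsq => ?_⟩
  obtain ⟨a, ha⟩ := h.2 (v.map e.symm) (by simpa using hv.map e.symm) (hsq.map_equiv e.symm)
  exact ⟨e a, by simpa using congrArg (List.map e) ha⟩

theorem leftExtremalSquareFree_P_append {A : List (Fin 3)} (hA : A = Qw ∨ A = Rw) :
    LeftExtremalSquareFree (Pw ++ A) := by
  apply leftExtremalSquareFree_of_check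
  rcases hA with rfl | rfl <;> decide +kernel

theorem leftExtremalSquareFree_reverse_append_S {A : List (Fin 3)} (hA : A = Qw ∨ A = Rw) :
    LeftExtremalSquareFree (A ++ Sw).reverse := by
  apply leftExtremalSquareFree_of_check
  rcases hA with rfl | rfl <;> decide +kernel

/-- Lemma 7: for every vertex `x` of `D`, every word in `δ(p_x x)` is left extremal
square-free, and every word in `δ(x s_x)` is right extremal square-free. -/
theorem delta_endpoints (x : V) :
    (∀ W ∈ SubstSet delta [Sum.inr (x, false), Sum.inl x], LeftExtremalSquareFree W) ∧
    (∀ W ∈ SubstSet delta [Sum.inl x, Sum.inr (x, true)], RightExtremalSquareFree W) := by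
  have mem_delta : ∀ B ∈ delta (Sum.inl x), ∃ A, (A = Qw ∨ A = Rw) ∧ B = applyV x A := by
    rintro B (rfl | rfl)
    · exact ⟨Qw, Or.inl rfl, rfl⟩
    · exact ⟨Rw, Or.inr rfl, rfl⟩
  constructor
  · rintro W ⟨_, rfl, B, ⟨_, hB, _, rfl, rfl⟩, rfl⟩
    obtain ⟨A, hA, rfl⟩ := mem_delta _ hB
    obtain ⟨π, _ | _⟩ := x
    · simpa [pword, applyV] using (leftExtremalSquareFree_P_append hA).map_equiv π
    · simpa [pword, applyV] using (leftExtremalSquareFree_reverse_append_S hA).map_equiv π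
  · rintro W ⟨_, hB, _, ⟨_, rfl, _, rfl, rfl⟩, rfl⟩
    obtain ⟨A, hA, rfl⟩ := mem_delta _ hB
    obtain ⟨π, _ | _⟩ := x
    · simpa [sword, applyV] using
        ((leftExtremalSquareFree_reverse_append_S hA).map_equiv π).reverse
    · simpa [sword, applyV] using ((leftExtremalSquareFree_P_append hA).map_equiv π).reverse
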